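/- Let (Ω, 𝒜, μ) be a probability space and 𝔉 : ℕ → sub-σ-algebras of 𝒜 a filtration (𝔉 s ⊆ 𝔉 (s+1) for all s). Let Y : ℕ → Ω → ℝ be a sequence of square-integrable random variables such that for every s: Y s is 𝔉(s+1)-measurable and μ[ Y s | 𝔉 s ] = 0 μ-almost everywhere. Assume ∑_{s=0}^{∞} μ[ (Y s)² ] / (s+1)² < ∞. Then μ-almost surely, (1/T) ∑_{s=0}^{T−1} Y s ω → 0 as T → ∞. (Strong law of large numbers for square-integrable martingale difference sequences.) -/

import Mathlib

open MeasureTheory Filter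

/-- **Kronecker's lemma** for the weights `s + 1`: if `∑ y s / (s + 1)` converges, then the
Cesàro averages of `y` converge to zero. -/
theorem tendsto_average_zero_of_tendsto_sum_div {y : ℕ → ℝ} {l : ℝ}
    (h : Tendsto (fun n : ℕ => ∑ s ∈ Finset.range n, y s / ((s : ℝ) + 1)) atTop (nhds l)) :
    Tendsto (fun T : ℕ => (1 / (T : ℝ)) * ∑ s ∈ Finset.range T, y s) atTop (nhds 0) := by
  set S : ℕ → ℝ := fun n => ∑ s ∈ Finset.range n, y s / ((s : ℝ) + 1)
  have summation_by_parts (T : ℕ) :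
      ∑ s ∈ Finset.range T, y s = T * S T - ∑ s ∈ Finset.range T, S s := by
    induction T with
    | zero => simp
    | succ T ih =>
      have hT : (T : ℝ) + 1 ≠ 0 := by positivity
      have hstep : S (T + 1) = S T + y T / ((T : ℝ) + 1) := Finset.sum_range_succ _ _
      rw [Finset.sum_range_succ, Finset.sum_range_succ, ih, hstep]
      push_cast
      field_simp
      ring
  have hlim := h.sub h.cesaro
  rw [sub_self] at hlim
  refine hlim.congr' ?_
  filter_upwards [eventually_gt_atTop 0] with T hT
  have hT' : (T : ℝ) ≠ 0 := by positivity
  rw [summation_by_parts]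
  field_simp

/-- A square-integrable random variable with vanishing conditional expectation is orthogonal to
every square-integrable variable that is measurable for the conditioning σ-algebra. -/
theorem integral_mul_eq_zero_of_condExp_eq_zero {Ω : Type*} {m m0 : MeasurableSpace Ω}
    {μ : Measure Ω} [IsFiniteMeasure μ] (hm : m ≤ m0) {f g : Ω → ℝ}
    (hf : StronglyMeasurable[m] f) (hf2 : MemLp f 2 μ) (hg2 : MemLp g 2 μ)
    (hg : μ[g | m] =ᵐ[μ] 0) : ∫ ω, f ω * g ω ∂μ = 0 := by
  have hfg : Integrable (f * g) μ := hf2.integrable_mul hg2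
  have hzero : μ[f * g | m] =ᵐ[μ] 0 := by
    filter_upwards [condExp_mul_of_stronglyMeasurable_left hf hfg
      (hg2.integrable one_le_two), hg] with ω h1 h2
    simp [h1, h2]
  change ∫ ω, (f * g) ω ∂μ = 0
  rw [← integral_condExp hm, integral_congr_ae hzero]
  simp

/-- Partial sums of square-integrable martingale differences form a martingale. -/
theorem martingale_sum_of_condExp_eq_zero {Ω : Type*} {m0 : MeasurableSpace Ω}
    {μ : Measure Ω} [IsFiniteMeasure μ] (ℱ : Filtration ℕ m0) {D : ℕ → Ω → ℝ}
    (hint : ∀ s, Integrable (D s) μ) (hmeas : ∀ s, StronglyMeasurable[ℱ (s + 1)] (D s))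
    (hD : ∀ s, μ[D s | ℱ s] =ᵐ[μ] 0) :
    Martingale (fun n => ∑ s ∈ Finset.range n, D s) ℱ μ := by
  have hadp : StronglyAdapted ℱ (fun n => ∑ s ∈ Finset.range n, D s) := fun n =>
    Finset.stronglyMeasurable_sum _ fun s hs =>
      (hmeas s).mono (ℱ.mono (Finset.mem_range.mp hs))
  have hsum (n : ℕ) : Integrable (∑ s ∈ Finset.range n, D s) μ :=
    integrable_finsetSum' _ fun s _ => hint s
  refine martingale_nat hadp hsum fun n => ?_
  have hself := condExp_of_stronglyMeasurable (μ := μ) (ℱ.le n) (hadp n) (hsum n)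
  simp only [Finset.sum_range_succ]
  filter_upwards [condExp_add (hsum n) (hint n) (ℱ n), hD n] with ω h1 h2
  simp only [h1, Pi.add_apply, hself, h2, Pi.zero_apply, add_zero]

/-- The second moment of a sum of martingale differences is the sum of the second moments. -/
theorem integral_sq_sum_of_condExp_eq_zero {Ω : Type*} {m0 : MeasurableSpace Ω}
    {μ : Measure Ω} [IsFiniteMeasure μ] (ℱ : Filtration ℕ m0) {D : ℕ → Ω → ℝ}
    (hL2 : ∀ s, MemLp (D s) 2 μ) (hmeas : ∀ s, StronglyMeasurable[ℱ (s + 1)] (D s))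
    (hD : ∀ s, μ[D s | ℱ s] =ᵐ[μ] 0) (n : ℕ) :
    ∫ ω, (∑ s ∈ Finset.range n, D s) ω ^ 2 ∂μ
      = ∑ s ∈ Finset.range n, ∫ ω, D s ω ^ 2 ∂μ := by
  induction n with
  | zero => simp
  | succ n ih =>
    set X : Ω → ℝ := ∑ s ∈ Finset.range n, D s with hX
    have hXL2 : MemLp X 2 μ := memLp_finsetSum' _ fun s _ => hL2 s
    have horth : ∫ ω, X ω * D n ω ∂μ = 0 :=
      integral_mul_eq_zero_of_condExp_eq_zero (ℱ.le n)
        ((martingale_sum_of_condExp_eq_zero ℱ (fun s => (hL2 s).integrable one_le_two)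
          hmeas hD).stronglyMeasurable n) hXL2 (hL2 n) (hD n)
    have hcross : Integrable (fun ω => 2 * (X ω * D n ω)) μ :=
      (hXL2.integrable_mul (hL2 n)).const_mul 2
    have hleft : Integrable (fun ω => X ω ^ 2 + 2 * (X ω * D n ω)) μ :=
      hXL2.integrable_sq.add hcross
    have hexpand : (fun ω => (X + D n) ω ^ 2)
        = fun ω => X ω ^ 2 + 2 * (X ω * D n ω) + D n ω ^ 2 := by
      ext ω
      simp only [Pi.add_apply]
      ring
    rw [Finset.sum_range_succ, Finset.sum_range_succ, ← ih, ← hX, hexpand,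
      integral_add hleft (hL2 n).integrable_sq,
      integral_add hXL2.integrable_sq hcross, integral_const_mul, horth, mul_zero, add_zero]

/-- On a probability space, the `L¹` seminorm is controlled by the second moment. -/
theorem eLpNorm_one_le_of_integral_sq_le {Ω : Type*} {m0 : MeasurableSpace Ω}
    {μ : Measure Ω} [IsProbabilityMeasure μ] {f : Ω → ℝ} (hf : MemLp f 2 μ) {C : ℝ}
    (hC : ∫ ω, f ω ^ 2 ∂μ ≤ C) : eLpNorm f 1 μ ≤ ((1 + C).toNNReal : ENNReal) := by
  rw [eLpNorm_one_eq_lintegral_enorm,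
    ← ofReal_integral_norm_eq_lintegral_enorm (hf.integrable one_le_two)]
  refine ENNReal.ofReal_le_ofReal ?_
  calc ∫ ω, ‖f ω‖ ∂μ ≤ ∫ ω, (1 + f ω ^ 2) ∂μ := by
        refine integral_mono (hf.integrable one_le_two).norm
          ((integrable_const 1).add hf.integrable_sq) fun ω => ?_
        simp only [Real.norm_eq_abs]
        nlinarith [sq_nonneg (|f ω| - 1), sq_abs (f ω), sq_nonneg (f ω)]
    _ = 1 + ∫ ω, f ω ^ 2 ∂μ := by
        rw [integral_add (integrable_const 1) hf.integrable_sq]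
        simp
    _ ≤ 1 + C := by linarith

/-- **Strong law of large numbers for square-integrable martingale difference
sequences**: if `∑ s, E[(Y s)²] / (s+1)² < ∞`, then the Cesàro averages of the
martingale differences converge to zero almost surely. -/
theorem mds_strong_law {Ω : Type*} [m0 : MeasurableSpace Ω]
    (μ : Measure Ω) [IsProbabilityMeasure μ]
    (F : ℕ → MeasurableSpace Ω) (hF_le : ∀ s, F s ≤ m0) (hF_mono : ∀ s, F s ≤ F (s + 1))
    (Y : ℕ → Ω → ℝ)
    (hL2 : ∀ s, MemLp (Y s) 2 μ)
    (hmeas : ∀ s, Measurable[F (s + 1)] (Y s))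
    (hmds : ∀ s, μ[Y s | F s] =ᵐ[μ] 0)
    (hsum : Summable fun s : ℕ => (∫ ω, (Y s ω) ^ 2 ∂μ) / ((s : ℝ) + 1) ^ 2) :
    ∀ᵐ ω ∂μ,
      Tendsto (fun T : ℕ => (1 / (T : ℝ)) * ∑ s ∈ Finset.range T, Y s ω)
        atTop (nhds 0) := by
  let ℱ : Filtration ℕ m0 := ⟨F, monotone_nat_of_le_succ hF_mono, hF_le⟩
  let D : ℕ → Ω → ℝ := fun s => ((s : ℝ) + 1)⁻¹ • Y s
  have hDL2 (s : ℕ) : MemLp (D s) 2 μ := (hL2 s).const_smul _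
  have hDmeas (s : ℕ) : StronglyMeasurable[ℱ (s + 1)] (D s) :=
    (hmeas s).stronglyMeasurable.const_smul _
  have hD (s : ℕ) : μ[D s | ℱ s] =ᵐ[μ] 0 := by
    filter_upwards [condExp_smul (μ := μ) ((s : ℝ) + 1)⁻¹ (Y s) (F s), hmds s] with ω h1 h2
    exact h1.trans (by simp [h2])
  have hDsq (s : ℕ) :
      ∫ ω, D s ω ^ 2 ∂μ = (∫ ω, (Y s ω) ^ 2 ∂μ) / ((s : ℝ) + 1) ^ 2 := by
    simp only [D, Pi.smul_apply, smul_eq_mul, mul_pow, integral_const_mul]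
    rw [inv_pow, inv_mul_eq_div]
  have hbound (n : ℕ) := eLpNorm_one_le_of_integral_sq_le
    (memLp_finsetSum' (Finset.range n) fun s _ => hDL2 s) (μ := μ)
    (C := ∑' s : ℕ, (∫ ω, (Y s ω) ^ 2 ∂μ) / ((s : ℝ) + 1) ^ 2) (by
      rw [integral_sq_sum_of_condExp_eq_zero ℱ hDL2 hDmeas hD, Finset.sum_congr rfl
        fun s _ => hDsq s]
      exact hsum.sum_le_tsum _ fun s _ => by positivity)
  have hmart := martingale_sum_of_condExp_eq_zero ℱ
    (fun s => (hDL2 s).integrable one_le_two) hDmeas hD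
  filter_upwards [hmart.submartingale.exists_ae_tendsto_of_bdd hbound] with ω ⟨l, hl⟩
  refine tendsto_average_zero_of_tendsto_sum_div (l := l) (hl.congr fun n => ?_)
  simp [D, Finset.sum_apply, div_eq_inv_mul]
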